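/- For positive integers a_1,...,a_n and positive reals b_1,...,b_n, with g_k = Σ_{i≤k} b_i and p_k = b_k/g_k, the integral F_{θ_n} = ∫_{0 ≤ t_1 ≤ ... ≤ t_n} ∏_i f_{a_i,b_i}(t_i) dt equals the sum over all integer tuples (ℓ_1,...,ℓ_{n-1}) with ℓ_i ≥ a_i of ∏_{j=2}^n NB_{a_j,p_j}(ℓ_1 + ... + ℓ_{j-1}). -/

import Mathlib

open MeasureTheory

/-- The Gamma(a, b) density `b^a t^{a-1} e^{-bt}/(a-1)!`. -/
noncomputable def gammaDensity (a : ℕ) (b t : ℝ) : ℝ :=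
  b ^ a * t ^ (a - 1) * Real.exp (-b * t) / ((a - 1).factorial : ℝ)

/-- The negative binomial probability mass function `NB_{m,p}(k)`. -/
noncomputable def negBinom (m : ℕ) (p : ℝ) (k : ℕ) : ℝ :=
  (Nat.choose (m - 1 + k) (m - 1) : ℝ) * (1 - p) ^ k * p ^ m

/-- The unbounded ordered simplex `0 ≤ t 0 ≤ t 1 ≤ ⋯`. -/
def orderedSimplex (n : ℕ) : Set (Fin n → ℝ) :=
  {t | (∀ i, 0 ≤ t i) ∧ ∀ i j : Fin n, i ≤ j → t i ≤ t j}

lemma measurableSet_orderedSimplex (n : ℕ) : MeasurableSet (orderedSimplex n) := by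
  unfold orderedSimplex
  measurability

lemma cons_mem_orderedSimplex_iff {n : ℕ} (x : ℝ) (s : Fin (n + 1) → ℝ) :
    (Fin.cons x s : Fin (n + 2) → ℝ) ∈ orderedSimplex (n + 2) ↔
      s ∈ orderedSimplex (n + 1) ∧ x ∈ Set.Icc 0 (s 0) := by
  constructor
  · rintro ⟨h0, h⟩
    exact ⟨⟨fun i => by simpa using h0 i.succ,
      fun i j hij => by simpa using h i.succ j.succ (Fin.succ_le_succ_iff.2 hij)⟩,
      by simpa using h0 0, by simpa using h 0 (Fin.succ 0) (Fin.zero_le _)⟩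
  · rintro ⟨⟨h0, h⟩, hx, hxs⟩
    refine ⟨Fin.cases (by simpa using hx) (fun i => by simpa using h0 i), ?_⟩
    refine Fin.cases (Fin.cases (by simp) fun j _ => ?_) fun i => Fin.cases (fun hi => ?_)
      fun j hij => ?_
    · simpa using hxs.trans (h 0 j (Fin.zero_le _))
    · exact absurd hi (by simp)
    · simpa using h i j (Fin.succ_le_succ_iff.1 hij)

/-- Integrating out the smallest variable over the ordered simplex. -/
lemma setLIntegral_orderedSimplex_succ {n : ℕ} {F : ℝ → ENNReal} {G : (Fin (n + 1) → ℝ) → ENNReal}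
    (hF : Measurable F) (hG : Measurable G) :
    ∫⁻ t in orderedSimplex (n + 2), F (t 0) * G (Fin.tail t) =
      ∫⁻ s in orderedSimplex (n + 1), (∫⁻ x in Set.Icc 0 (s 0), F x) * G s := by
  have htail : Measurable (Fin.tail : (Fin (n + 2) → ℝ) → Fin (n + 1) → ℝ) :=
    measurable_pi_iff.2 fun i => measurable_pi_apply i.succ
  have hmeas : Measurable fun t : Fin (n + 2) → ℝ => F (t 0) * G (Fin.tail t) :=
    (hF.comp (measurable_pi_apply 0)).mul (hG.comp htail)
  rw [← lintegral_indicator (measurableSet_orderedSimplex _),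
    ← lintegral_indicator (measurableSet_orderedSimplex _),
    ← ((volume_preserving_piFinSuccAbove (fun _ : Fin (n + 2) => ℝ) 0).symm _).lintegral_comp_emb
      (MeasurableEquiv.measurableEmbedding _), Measure.volume_eq_prod]
  refine (lintegral_prod_symm' _ ((hmeas.indicator (measurableSet_orderedSimplex _)).comp
      (MeasurableEquiv.piFinSuccAbove (fun _ : Fin (n + 2) => ℝ) 0).symm.measurable)).trans
    (lintegral_congr fun s => ?_)
  simp only [Function.comp_apply]
  have key : ∀ x : ℝ, (orderedSimplex (n + 2)).indicator (fun t => F (t 0) * G (Fin.tail t))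
      ((MeasurableEquiv.piFinSuccAbove (fun _ : Fin (n + 2) => ℝ) 0).symm (x, s)) =
      (orderedSimplex (n + 1)).indicator
        (fun s => (Set.Icc 0 (s 0)).indicator F x * G s) s := by
    intro x
    have hcons : (MeasurableEquiv.piFinSuccAbove (fun _ : Fin (n + 2) => ℝ) 0).symm (x, s) =
        (Fin.cons x s : Fin (n + 2) → ℝ) := by
      simp [MeasurableEquiv.piFinSuccAbove_symm_apply, Fin.insertNthEquiv]
    rw [hcons]
    have h := cons_mem_orderedSimplex_iff x s
    by_cases hs : s ∈ orderedSimplex (n + 1) <;> by_cases hx : x ∈ Set.Icc 0 (s 0) <;>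
      simp only [hs, hx, and_self, and_true, and_false, iff_true, iff_false] at h <;>
      simp [Set.indicator_of_mem, Set.indicator_of_notMem, hs, hx, h]
  simp_rw [key]
  by_cases hs : s ∈ orderedSimplex (n + 1)
  · simp only [Set.indicator_of_mem hs]
    rw [lintegral_mul_const _ (hF.indicator measurableSet_Icc),
      lintegral_indicator measurableSet_Icc]
  · simp [Set.indicator_of_notMem hs]

lemma measurable_gammaDensity (a : ℕ) (b : ℝ) : Measurable (gammaDensity a b) := by
  unfold gammaDensity
  fun_prop

lemma gammaDensity_nonneg (a : ℕ) {b t : ℝ} (hb : 0 ≤ b) (ht : 0 ≤ t) :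
    0 ≤ gammaDensity a b t := by
  unfold gammaDensity
  positivity

lemma negBinom_nonneg (m k : ℕ) {p : ℝ} (hp : 0 ≤ p) (hp' : p ≤ 1) : 0 ≤ negBinom m p k := by
  have : 0 ≤ 1 - p := sub_nonneg.2 hp'
  unfold negBinom
  positivity

/-- The Poisson weight with mean `y`. -/
noncomputable def poissonWeight (y : ℝ) (k : ℕ) : ℝ :=
  Real.exp (-y) * y ^ k / (k.factorial : ℝ)

lemma poissonWeight_nonneg {y : ℝ} (hy : 0 ≤ y) (k : ℕ) : 0 ≤ poissonWeight y k := by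
  unfold poissonWeight
  positivity

lemma hasSum_poissonWeight (y : ℝ) : HasSum (poissonWeight y) 1 := by
  have h := (NormedSpace.expSeries_div_hasSum_exp y).mul_left (Real.exp (-y))
  rw [← Real.exp_eq_exp_ℝ, ← Real.exp_add, neg_add_cancel, Real.exp_zero] at h
  exact h.congr_fun fun k => mul_div_assoc _ _ _

lemma hasDerivAt_neg_sum_poissonWeight (a : ℕ) (b x : ℝ) :
    HasDerivAt (fun x => -∑ k ∈ Finset.range (a + 1), poissonWeight (b * x) k)
      (gammaDensity (a + 1) b x) x := by
  have hexp : HasDerivAt (fun x => Real.exp (-(b * x))) (Real.exp (-(b * x)) * -b) x := by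
    simpa using (((hasDerivAt_id x).const_mul b).fun_neg).exp
  induction a with
  | zero =>
    simpa [poissonWeight, gammaDensity, mul_comm] using hexp.fun_neg
  | succ a ih =>
    have hpow : HasDerivAt (fun x => (b * x) ^ (a + 1)) ((a + 1 : ℕ) * (b * x) ^ a * b) x := by
      simpa using ((hasDerivAt_id x).const_mul b).fun_pow (a + 1)
    have hsub := ih.fun_sub ((hexp.fun_mul hpow).div_const ((a + 1).factorial : ℝ))
    simp_rw [Finset.sum_range_succ _ (a + 1), neg_add, ← sub_eq_add_neg]
    refine hsub.congr_deriv ?_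
    simp only [gammaDensity, Nat.add_sub_cancel, Nat.factorial_succ, Nat.cast_mul, Nat.cast_add,
      Nat.cast_one, neg_mul]
    field_simp
    ring

/-- The Gamma distribution function is the tail of a Poisson distribution. -/
lemma setLIntegral_gammaDensity_Icc (m : ℕ) {a : ℕ} (ha : 0 < a) {b t : ℝ} (hb : 0 ≤ b)
    (ht : 0 ≤ t) :
    ∫⁻ x in Set.Icc 0 t, ENNReal.ofReal (gammaDensity (m + a) b x) =
      ∑' l : ℕ, if a ≤ l then ENNReal.ofReal (poissonWeight (b * t) (m + l)) else 0 := by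
  obtain ⟨N, hN⟩ : ∃ N, m + a = N + 1 := ⟨m + a - 1, by omega⟩
  have hcont : Continuous (gammaDensity (N + 1) b) := by
    unfold gammaDensity
    fun_prop
  have hnonneg : ∀ᵐ x ∂volume.restrict (Set.Icc 0 t), 0 ≤ gammaDensity (N + 1) b x :=
    ae_restrict_of_forall_mem measurableSet_Icc fun x hx => gammaDensity_nonneg _ hb hx.1
  have hint : ∫ x in Set.Icc 0 t, gammaDensity (N + 1) b x =
      1 - ∑ k ∈ Finset.range (N + 1), poissonWeight (b * t) k := by
    rw [integral_Icc_eq_integral_Ioc, ← intervalIntegral.integral_of_le ht,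
      intervalIntegral.integral_eq_sub_of_hasDerivAt
        (fun x _ => hasDerivAt_neg_sum_poissonWeight N b x) (hcont.intervalIntegrable _ _),
      Finset.sum_range_succ' (poissonWeight (b * 0))]
    simp [poissonWeight]
    ring
  have hsum : HasSum (fun k => poissonWeight (b * t) (k + (N + 1))) _ :=
    (hasSum_nat_add_iff' (N + 1)).2 (hasSum_poissonWeight (b * t))
  have htail : ∑' l : ℕ, (if a ≤ l then ENNReal.ofReal (poissonWeight (b * t) (m + l)) else 0) =
      ∑' k : ℕ, ENNReal.ofReal (poissonWeight (b * t) (k + (N + 1))) := by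
    have hsplit := ENNReal.summable.sum_add_tsum_nat_add' (k := a)
      (f := fun l => if a ≤ l then ENNReal.ofReal (poissonWeight (b * t) (m + l)) else 0)
    rw [← hsplit, Finset.sum_eq_zero fun l hl => if_neg (not_le.2 (Finset.mem_range.1 hl)),
      zero_add]
    refine tsum_congr fun k => ?_
    rw [if_pos (Nat.le_add_left _ _), ← hN, show k + (m + a) = m + (k + a) by ring]
  rw [hN, ← ofReal_integral_eq_lintegral_ofReal hcont.integrableOn_Icc hnonneg, hint, htail,
    ← hsum.tsum_eq, ENNReal.ofReal_tsum_of_nonneg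
      (fun k => poissonWeight_nonneg (mul_nonneg hb ht) _) hsum.summable]

lemma setLIntegral_gammaDensity_Ici {a : ℕ} (ha : 0 < a) {b : ℝ} (hb : 0 < b) :
    ∫⁻ x in Set.Ici 0, ENNReal.ofReal (gammaDensity a b x) = 1 := by
  rw [← ProbabilityTheory.lintegral_gammaPDF_eq_one (a := a) (Nat.cast_pos.2 ha) hb,
    ← lintegral_indicator measurableSet_Ici]
  refine lintegral_congr fun x => ?_
  obtain ⟨N, rfl⟩ : ∃ N, a = N + 1 := ⟨a - 1, by omega⟩
  by_cases hx : 0 ≤ x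
  · rw [Set.indicator_of_mem (Set.mem_Ici.2 hx), ProbabilityTheory.gammaPDF,
      ProbabilityTheory.gammaPDFReal, if_pos hx, Real.rpow_natCast]
    congr 1
    rw [Nat.cast_succ, Real.Gamma_nat_eq_factorial, add_sub_cancel_right, Real.rpow_natCast,
      gammaDensity, Nat.add_sub_cancel, neg_mul]
    ring
  · rw [Set.indicator_of_notMem (by simpa using hx), ProbabilityTheory.gammaPDF,
      ProbabilityTheory.gammaPDFReal, if_neg hx, ENNReal.ofReal_zero]

/-- Bayes formula for a Poisson observation with a Gamma prior. -/
lemma poissonWeight_mul_gammaDensity {a : ℕ} (ha : 0 < a) {b c : ℝ} (hbc : b + c ≠ 0)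
    (k : ℕ) (t : ℝ) :
    poissonWeight (c * t) k * gammaDensity a b t =
      negBinom a (b / (c + b)) k * gammaDensity (k + a) (c + b) t := by
  obtain ⟨N, rfl⟩ : ∃ N, a = N + 1 := ⟨a - 1, by omega⟩
  have hcb : c + b ≠ 0 := by rwa [add_comm]
  have hchoose : ((N + k).choose N : ℝ) = (N + k).factorial / (N.factorial * k.factorial) := by
    rw [Nat.cast_choose ℝ (Nat.le_add_right _ _), Nat.add_sub_cancel_left]
  have hexp : Real.exp (-((c + b) * t)) = Real.exp (-(c * t)) * Real.exp (-(b * t)) := by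
    rw [← Real.exp_add]; ring_nf
  have hp : 1 - b / (c + b) = c / (c + b) := by field_simp; ring
  simp only [poissonWeight, gammaDensity, negBinom, Nat.add_sub_cancel, ← Nat.add_assoc, neg_mul,
    hexp, hchoose, hp, Nat.add_comm k N]
  have : ((N + k).factorial : ℝ) ≠ 0 := by positivity
  have : (N.factorial : ℝ) ≠ 0 := by positivity
  have : (k.factorial : ℝ) ≠ 0 := by positivity
  rw [div_pow, div_pow]
  field_simp
  ring

lemma Fin.sum_Iic_succ {M : Type*} [AddCommMonoid M] {n : ℕ} (f : Fin (n + 1) → M) (j : Fin n) :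
    ∑ i ∈ Finset.Iic j.succ, f i = f 0 + ∑ i ∈ Finset.Iic j, f i.succ := by
  have h : Finset.Iic j.succ = insert 0 ((Finset.Iic j).map (Fin.succEmb n)) := by
    ext i
    refine Fin.cases ?_ (fun i => ?_) i <;> simp
  rw [h, Finset.sum_insert (by simp), Finset.sum_map]
  rfl

lemma Fin.sum_Iic_zero {M : Type*} [AddCommMonoid M] {n : ℕ} (f : Fin (n + 1) → M) :
    ∑ i ∈ Finset.Iic 0, f i = f 0 := by
  rw [show Finset.Iic (0 : Fin (n + 1)) = {0} by ext i; simp, Finset.sum_singleton]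

lemma setLIntegral_orderedSimplex_eq_tsum (n : ℕ) (m : ℕ) {c : ℝ} (hc : 0 ≤ c)
    (a : Fin (n + 1) → ℕ) (ha : ∀ i, 0 < a i) (b : Fin (n + 1) → ℝ) (hb : ∀ i, 0 < b i) :
    ∫⁻ t in orderedSimplex (n + 1), ENNReal.ofReal (gammaDensity (m + a 0) (c + b 0) (t 0)) *
        ∏ i : Fin n, ENNReal.ofReal (gammaDensity (a i.succ) (b i.succ) (t i.succ)) =
      ∑' ℓ : Fin n → ℕ,
        if ∀ i : Fin n, a i.castSucc ≤ ℓ i then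
          ∏ j : Fin n, ENNReal.ofReal
            (negBinom (a j.succ) (b j.succ / (c + ∑ i ∈ Finset.Iic j.succ, b i))
              (m + ∑ i ∈ Finset.Iic j, ℓ i))
        else 0 := by
  induction n generalizing m c with
  | zero =>
    have hpre : orderedSimplex 1 = MeasurableEquiv.funUnique (Fin 1) ℝ ⁻¹' Set.Ici 0 := by
      ext t
      simp [orderedSimplex, Subsingleton.elim _ (0 : Fin 1)]
    rw [hpre]
    simp only [Finset.univ_eq_empty, Finset.prod_empty, mul_one]
    have := (volume_preserving_funUnique (Fin 1) ℝ).setLIntegral_comp_preimage_emb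
      (MeasurableEquiv.measurableEmbedding _)
      (fun x => ENNReal.ofReal (gammaDensity (m + a 0) (c + b 0) x)) (Set.Ici 0)
    rw [setLIntegral_gammaDensity_Ici (Nat.add_pos_right _ (ha 0))
      (add_pos_of_nonneg_of_pos hc (hb 0))] at this
    refine this.trans ?_
    simp
  | succ n ih =>
    have hpos : 0 < c + b 0 := add_pos_of_nonneg_of_pos hc (hb 0)
    set P : (Fin (n + 1) → ℝ) → ENNReal := fun s =>
      ∏ i : Fin n, ENNReal.ofReal (gammaDensity (a i.succ.succ) (b i.succ.succ) (s i.succ))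
    have hPm : Measurable P := Finset.measurable_prod _ fun i _ =>
      ((measurable_gammaDensity _ _).comp (measurable_pi_apply _)).ennreal_ofReal
    have hgm (k : ℕ) (d : ℝ) (i : Fin (n + 1)) : Measurable fun s : Fin (n + 1) → ℝ =>
        ENNReal.ofReal (gammaDensity k d (s i)) :=
      ((measurable_gammaDensity k d).comp (measurable_pi_apply i)).ennreal_ofReal
    have hsplit := setLIntegral_orderedSimplex_succ (n := n)
      (F := fun x => ENNReal.ofReal (gammaDensity (m + a 0) (c + b 0) x))
      (G := fun s => ENNReal.ofReal (gammaDensity (a 1) (b 1) (s 0)) * P s)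
      (measurable_gammaDensity _ _).ennreal_ofReal ((hgm _ _ _).mul hPm)
    simp_rw [Fin.prod_univ_succ (n := n)]
    refine hsplit.trans ?_
    have hq0 : 0 ≤ b 1 / (c + b 0 + b 1) := by have := hb 1; positivity
    have hq1 : b 1 / (c + b 0 + b 1) ≤ 1 :=
      div_le_one_of_le₀ (by linarith) (by have := hb 1; positivity)
    have hGm (k : ℕ) (d : ℝ) : Measurable fun s : Fin (n + 1) → ℝ =>
        ENNReal.ofReal (gammaDensity k d (s 0)) * P s := (hgm k d 0).mul hPm
    have hint : ∀ s ∈ orderedSimplex (n + 1),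
        (∫⁻ x in Set.Icc 0 (s 0), ENNReal.ofReal (gammaDensity (m + a 0) (c + b 0) x)) *
          (ENNReal.ofReal (gammaDensity (a 1) (b 1) (s 0)) * P s) =
        ∑' l : ℕ, (if a 0 ≤ l then
            ENNReal.ofReal (negBinom (a 1) (b 1 / (c + b 0 + b 1)) (m + l)) else 0) *
          (ENNReal.ofReal (gammaDensity (m + l + a 1) (c + b 0 + b 1) (s 0)) * P s) := by
      intro s hs
      rw [setLIntegral_gammaDensity_Icc m (ha 0) hpos.le (hs.1 0), ← ENNReal.tsum_mul_right]
      refine tsum_congr fun l => ?_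
      split_ifs
      · rw [← mul_assoc, ← mul_assoc,
          ← ENNReal.ofReal_mul (poissonWeight_nonneg (mul_nonneg hpos.le (hs.1 0)) _),
          ← ENNReal.ofReal_mul (negBinom_nonneg _ _ hq0 hq1),
          poissonWeight_mul_gammaDensity (ha 1) (by have := hb 1; positivity)]
      · simp
    rw [setLIntegral_congr_fun (measurableSet_orderedSimplex _) hint,
      lintegral_tsum fun l => ((hGm _ _).const_mul _).aemeasurable,
      ← (Fin.consEquiv fun _ : Fin (n + 1) => ℕ).tsum_eq, ENNReal.tsum_prod']
    refine tsum_congr fun l => ?_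
    rw [lintegral_const_mul _ (hGm _ _)]
    have hih := ih (m + l) hpos.le (Fin.tail a) (fun i => ha i.succ) (Fin.tail b)
      (fun i => hb i.succ)
    simp only [Fin.tail, Fin.succ_zero_eq_one] at hih
    rw [hih, ← ENNReal.tsum_mul_left]
    refine tsum_congr fun ℓ => ?_
    have hIic : ∑ i ∈ Finset.Iic (1 : Fin (n + 2)), b i = b 0 + b 1 := by
      rw [← Fin.succ_zero_eq_one, Fin.sum_Iic_succ, Fin.sum_Iic_zero]
    simp only [Fin.consEquiv_apply, Fin.forall_fin_succ, Fin.castSucc_zero, Fin.cons_zero,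
      Fin.cons_succ, hIic, Fin.sum_Iic_succ, Fin.sum_Iic_zero, Fin.succ_zero_eq_one,
      ← Fin.succ_castSucc, add_assoc]
    by_cases h1 : a 0 ≤ l <;> by_cases h2 : ∀ i : Fin n, a i.castSucc.succ ≤ ℓ i <;>
      simp [h1, h2]

/-- The simplex integral `F_{θ_n}` over the unbounded ordered simplex equals a sum of
products of negative binomial probabilities.  Here there are `n + 1` variables
`t 0 ≤ t 1 ≤ ⋯ ≤ t n`, and the sum ranges over tuples `ℓ : Fin n → ℕ` with
`ℓ i ≥ a i` (for the first `n` shape parameters), the `j`-th factor being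
`NB_{a_{j+1}, p_{j+1}}(ℓ 0 + ⋯ + ℓ j)` with `p_k = b k / (b 0 + ⋯ + b k)`. -/
theorem simplex_integral_eq_negBinom_sum (n : ℕ) (hn : 0 < n)
    (a : Fin (n + 1) → ℕ) (ha : ∀ i, 0 < a i)
    (b : Fin (n + 1) → ℝ) (hb : ∀ i, 0 < b i) :
    (∫ t in {t : Fin (n + 1) → ℝ | (∀ i, 0 ≤ t i) ∧ ∀ i j : Fin (n + 1), i ≤ j → t i ≤ t j},
        ∏ i : Fin (n + 1), gammaDensity (a i) (b i) (t i)) =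
      ∑' ℓ : Fin n → ℕ,
        if ∀ i : Fin n, a i.castSucc ≤ ℓ i then
          ∏ j : Fin n,
            negBinom (a j.succ) (b j.succ / ∑ i ∈ Finset.Iic j.succ, b i)
              (∑ i ∈ Finset.Iic j, ℓ i)
        else 0 := by
  have hℓ : ∀ j : Fin n, 0 ≤ b j.succ / ∑ i ∈ Finset.Iic j.succ, b i ∧
      b j.succ / ∑ i ∈ Finset.Iic j.succ, b i ≤ 1 := fun j =>
    ⟨div_nonneg (hb _).le (Finset.sum_nonneg fun i _ => (hb i).le),
      div_le_one_of_le₀ (Finset.single_le_sum (fun i _ => (hb i).le) (Finset.mem_Iic.2 le_rfl))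
        (Finset.sum_nonneg fun i _ => (hb i).le)⟩
  have hmain := setLIntegral_orderedSimplex_eq_tsum n 0 le_rfl a ha b hb
  simp only [zero_add] at hmain
  change ∫ t in orderedSimplex (n + 1), _ = _
  rw [integral_eq_lintegral_of_nonneg_ae
    (ae_restrict_of_forall_mem (measurableSet_orderedSimplex _) fun t ht =>
      Finset.prod_nonneg fun i _ => gammaDensity_nonneg _ (hb i).le (ht.1 i))
    (Finset.measurable_fun_prod _ fun i _ =>
      (measurable_gammaDensity _ _).comp (measurable_pi_apply i)).aestronglyMeasurable,
    setLIntegral_congr_fun (measurableSet_orderedSimplex _) fun t ht => by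
      rw [ENNReal.ofReal_prod_of_nonneg fun i _ => gammaDensity_nonneg _ (hb i).le (ht.1 i),
        Fin.prod_univ_succ], hmain, ENNReal.tsum_toReal_eq]
  · refine tsum_congr fun ℓ => ?_
    split_ifs
    · rw [ENNReal.toReal_prod]
      exact Finset.prod_congr rfl fun j _ =>
        ENNReal.toReal_ofReal (negBinom_nonneg _ _ (hℓ j).1 (hℓ j).2)
    · rfl
  · intro ℓ
    split_ifs
    · exact ENNReal.prod_ne_top fun _ _ => ENNReal.ofReal_ne_top
    · exact ENNReal.zero_ne_top
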